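/- arXiv:1912.11496 — 2 statements merged into one kernel-verified Lean document; each statement's English description precedes it below -/
import Mathlib

section
/- Let q be a prime power, r a positive integer dividing q−1, and a, b, c nonzero elements of the finite field F_q. If q ≥ r^4 and r ≥ 2, then there exist x, y, z ∈ F_q, all nonzero, such that a·x^r + b·y^r + c·z^r = 0. -/
open Finset

section PowerSum

variable {F : Type*} [Field F] [Fintype F]

/-- A sum over a finite field splits into the value at zero and a sum over the units. -/
lemma sum_eq_apply_zero_add_sum_units {M : Type*} [AddCommMonoid M] [DecidableEq F] (f : F → M) :
    ∑ t, f t = f 0 + ∑ u : Fˣ, f u := by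
  rw [← Finset.add_sum_erase _ _ (mem_univ (0 : F))]
  congr 1
  refine Finset.sum_bij' (fun t ht ↦ Units.mk0 t (Finset.ne_of_mem_erase ht)) (fun u _ ↦ (u : F))
    ?_ ?_ ?_ ?_ ?_ <;> simp

/-- An element of a finite field has at most `r` nonzero `r`-th roots. -/
lemma card_units_pow_eq_le [DecidableEq F] {r : ℕ} (hr : 0 < r) (a : Fˣ) :
    #{u : Fˣ | u ^ r = a} ≤ r := by
  calc #{u : Fˣ | u ^ r = a} ≤ #(Polynomial.nthRoots r (a : F)).toFinset := by
        refine Finset.card_le_card_of_injOn (fun u ↦ (u : F)) ?_ (Units.val_injective.injOn)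
        intro u hu
        simp only [coe_filter, mem_univ, true_and, Set.mem_ofPred_eq] at hu
        simp [Polynomial.mem_nthRoots hr, ← hu]
    _ ≤ r := (Multiset.toFinset_card_le _).trans (Polynomial.card_nthRoots r _)

/-- The exponential sum `∑ ψ (t * x ^ r)` over the nonzero `x`. -/
noncomputable def unitPowSum [DecidableEq F] (ψ : AddChar F ℂ) (r : ℕ) (t : F) : ℂ :=
  ∑ x : Fˣ, ψ (t * (x : F) ^ r)

variable [DecidableEq F] {ψ : AddChar F ℂ} {r : ℕ}

lemma unitPowSum_zero : unitPowSum ψ r 0 = Fintype.card Fˣ := by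
  simp [unitPowSum]

lemma unitPowSum_mul_pow (t u : Fˣ) :
    unitPowSum ψ r ((t * u ^ r : Fˣ) : F) = unitPowSum ψ r t := by
  unfold unitPowSum
  refine Fintype.sum_equiv (Equiv.mulLeft u) _ _ fun x ↦ ?_
  simp [mul_pow, mul_assoc]

lemma sum_norm_sq_unitPowSum (hψ : ψ.IsPrimitive) :
    ∑ t, ‖unitPowSum ψ r t‖ ^ 2 =
      Fintype.card F * ∑ y : Fˣ, (#{x : Fˣ | x ^ r = y ^ r} : ℝ) := by
  have key : ∑ t, unitPowSum ψ r t * (starRingEnd ℂ) (unitPowSum ψ r t) =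
      Fintype.card F * ∑ y : Fˣ, (#{x : Fˣ | x ^ r = y ^ r} : ℂ) := by
    have expand (t : F) : unitPowSum ψ r t * (starRingEnd ℂ) (unitPowSum ψ r t) =
        ∑ y : Fˣ, ∑ x : Fˣ, ψ (t * ((x : F) ^ r - (y : F) ^ r)) := by
      simp only [unitPowSum, map_sum, Finset.mul_sum, Finset.sum_mul, ← AddChar.map_neg_eq_conj,
        ← AddChar.map_add_eq_mul, sub_eq_add_neg, mul_add, mul_neg]
    simp only [expand]
    rw [Finset.sum_comm, Finset.mul_sum]
    refine Finset.sum_congr rfl fun y _ ↦ ?_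
    rw [Finset.sum_comm]
    simp [AddChar.sum_mulShift _ hψ, sub_eq_zero, Units.ext_iff, Finset.sum_ite, mul_comm]
  simp only [Complex.mul_conj, Complex.normSq_eq_norm_sq] at key
  exact_mod_cast key

lemma sum_units_norm_sq_unitPowSum_le (hr : 0 < r) (hψ : ψ.IsPrimitive) :
    ∑ t : Fˣ, ‖unitPowSum ψ r t‖ ^ 2 ≤
      Fintype.card Fˣ * (Fintype.card F * r - Fintype.card Fˣ : ℝ) := by
  have h := sum_norm_sq_unitPowSum (r := r) hψ
  rw [sum_eq_apply_zero_add_sum_units, unitPowSum_zero, Complex.norm_natCast] at h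
  have hK : ∑ y : Fˣ, (#{x : Fˣ | x ^ r = y ^ r} : ℝ) ≤ Fintype.card Fˣ * r := by
    calc ∑ y : Fˣ, (#{x : Fˣ | x ^ r = y ^ r} : ℝ) ≤ ∑ _y : Fˣ, (r : ℝ) :=
          Finset.sum_le_sum fun y _ ↦ by exact_mod_cast card_units_pow_eq_le hr (y ^ r)
      _ = Fintype.card Fˣ * r := by simp
  have := mul_le_mul_of_nonneg_left hK (Nat.cast_nonneg (α := ℝ) (Fintype.card F))
  linarith

lemma norm_sq_unitPowSum_le (hr : 0 < r) (hψ : ψ.IsPrimitive) (t : Fˣ) :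
    ‖unitPowSum ψ r t‖ ^ 2 ≤ r * (Fintype.card F * r - Fintype.card Fˣ : ℝ) := by
  have hn : (0 : ℝ) < Fintype.card Fˣ := by exact_mod_cast Fintype.card_pos
  have horbit : Fintype.card Fˣ * ‖unitPowSum ψ r t‖ ^ 2 ≤
      r * ∑ s : Fˣ, ‖unitPowSum ψ r s‖ ^ 2 := by
    calc Fintype.card Fˣ * ‖unitPowSum ψ r t‖ ^ 2
        = ∑ u : Fˣ, ‖unitPowSum ψ r ((t * u ^ r : Fˣ) : F)‖ ^ 2 := by
          simp only [unitPowSum_mul_pow]; simp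
      _ = ∑ s : Fˣ, ∑ u : Fˣ with t * u ^ r = s,
            ‖unitPowSum ψ r ((t * u ^ r : Fˣ) : F)‖ ^ 2 :=
          (Finset.sum_fiberwise _ _ _).symm
      _ = ∑ s : Fˣ, #{u : Fˣ | u ^ r = t⁻¹ * s} * ‖unitPowSum ψ r s‖ ^ 2 := by
          refine Finset.sum_congr rfl fun s _ ↦ ?_
          simp only [← eq_inv_mul_iff_mul_eq]
          rw [← nsmul_eq_mul]
          refine Finset.sum_eq_card_nsmul fun u hu ↦ ?_
          rw [(mem_filter.mp hu).2, mul_inv_cancel_left]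
      _ ≤ ∑ s : Fˣ, r * ‖unitPowSum ψ r s‖ ^ 2 := by
          gcongr with s
          exact card_units_pow_eq_le hr _
      _ = r * ∑ s : Fˣ, ‖unitPowSum ψ r s‖ ^ 2 := (Finset.mul_sum _ _ _).symm
  have h := mul_le_mul_of_nonneg_left (sum_units_norm_sq_unitPowSum_le hr hψ)
    (Nat.cast_nonneg (α := ℝ) r)
  refine le_of_mul_le_mul_left (horbit.trans (h.trans_eq ?_)) hn
  ring

/-- If `a x ^ r + b y ^ r + c z ^ r` never vanishes on nonzero arguments, then the associated
product of exponential sums has mean zero. -/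
lemma sum_unitPowSum_mul_eq_zero (hψ : ψ.IsPrimitive) {a b c : F}
    (h : ∀ x y z : Fˣ, a * (x : F) ^ r + b * (y : F) ^ r + c * (z : F) ^ r ≠ 0) :
    ∑ t, unitPowSum ψ r (t * a) * unitPowSum ψ r (t * b) * unitPowSum ψ r (t * c) = 0 := by
  have expand (t : F) :
      unitPowSum ψ r (t * a) * unitPowSum ψ r (t * b) * unitPowSum ψ r (t * c) =
        ∑ z : Fˣ, ∑ y : Fˣ, ∑ x : Fˣ,
          ψ (t * (a * (x : F) ^ r + b * (y : F) ^ r + c * (z : F) ^ r)) := by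
    simp only [unitPowSum, Finset.mul_sum, Finset.sum_mul, ← AddChar.map_add_eq_mul, mul_add,
      mul_assoc]
  simp only [expand]
  rw [Finset.sum_comm]
  refine Finset.sum_eq_zero fun z _ ↦ ?_
  rw [Finset.sum_comm]
  refine Finset.sum_eq_zero fun y _ ↦ ?_
  rw [Finset.sum_comm]
  refine Finset.sum_eq_zero fun x _ ↦ ?_
  rw [AddChar.sum_mulShift _ hψ, if_neg (h x y z), Nat.cast_zero]

lemma norm_sum_units_unitPowSum_mul_le {B : ℝ} (hB : ∀ t : Fˣ, ‖unitPowSum ψ r t‖ ≤ B)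
    (a b c : Fˣ) :
    ‖∑ t : Fˣ, unitPowSum ψ r ((t * a : Fˣ) : F) * unitPowSum ψ r ((t * b : Fˣ) : F) *
      unitPowSum ψ r ((t * c : Fˣ) : F)‖ ≤ B * ∑ t : Fˣ, ‖unitPowSum ψ r t‖ ^ 2 := by
  have hB0 : 0 ≤ B := (norm_nonneg _).trans (hB 1)
  have shift (d : Fˣ) : ∑ t : Fˣ, ‖unitPowSum ψ r ((t * d : Fˣ) : F)‖ ^ 2 =
      ∑ t : Fˣ, ‖unitPowSum ψ r t‖ ^ 2 :=
    Fintype.sum_equiv (Equiv.mulRight d) _ _ fun _ ↦ rfl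
  calc _ ≤ ∑ t : Fˣ, B * ((‖unitPowSum ψ r ((t * b : Fˣ) : F)‖ ^ 2 +
        ‖unitPowSum ψ r ((t * c : Fˣ) : F)‖ ^ 2) / 2) := by
        refine norm_sum_le_of_le _ fun t _ ↦ ?_
        rw [norm_mul, norm_mul, mul_assoc]
        refine mul_le_mul (hB _) ?_ (by positivity) hB0
        nlinarith [sq_nonneg (‖unitPowSum ψ r ((t * b : Fˣ) : F)‖ -
          ‖unitPowSum ψ r ((t * c : Fˣ) : F)‖)]
    _ = B * ∑ t : Fˣ, ‖unitPowSum ψ r t‖ ^ 2 := by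
        rw [← Finset.mul_sum, ← Finset.sum_div, Finset.sum_add_distrib, shift, shift]
        ring

end PowerSum

lemma mul_cube_lt_pow_four {r q : ℝ} (hr : 2 ≤ r) (hq : r ^ 4 ≤ q) :
    r * (q * r - (q - 1)) ^ 3 < (q - 1) ^ 4 := by
  have h8 : 8 * r ≤ q := by
    calc 8 * r = 2 ^ 3 * r := by norm_num
      _ ≤ r ^ 3 * r := by gcongr
      _ = r ^ 4 := by ring
      _ ≤ q := hq
  have hq16 : 16 ≤ q := by linarith
  have hE : q * r - (q - 1) ≤ r * (q - 7) := by nlinarith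
  have hE0 : 0 ≤ q * r - (q - 1) := by nlinarith
  calc r * (q * r - (q - 1)) ^ 3 ≤ r * (r * (q - 7)) ^ 3 := by gcongr
    _ = r ^ 4 * (q - 7) ^ 3 := by ring
    _ ≤ q * (q - 7) ^ 3 := by
        have : 0 ≤ q - 7 := by linarith
        gcongr
    _ < (q - 1) ^ 4 := by nlinarith [sq_nonneg q, pow_nonneg (by linarith : (0 : ℝ) ≤ q) 3]

/-- For a finite field `F` with `q` elements, `r ≥ 2` dividing `q - 1` and
`q ≥ r^4`, any equation `a x^r + b y^r + c z^r = 0` with `a, b, c` nonzero has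
a solution with `x, y, z` all nonzero. -/
theorem stmt_1 (F : Type*) [Field F] [Fintype F] (r : ℕ) (hr : 2 ≤ r)
    (hdvd : r ∣ Fintype.card F - 1) (hq : r ^ 4 ≤ Fintype.card F)
    (a b c : F) (ha : a ≠ 0) (hb : b ≠ 0) (hc : c ≠ 0) :
    ∃ x y z : F, x ≠ 0 ∧ y ≠ 0 ∧ z ≠ 0 ∧ a * x ^ r + b * y ^ r + c * z ^ r = 0 := by
  classical
  by_contra! hno
  have hr0 : 0 < r := by lia
  have hψ := AddChar.FiniteField.primitiveChar_to_Complex_isPrimitive F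
  set ψ := AddChar.FiniteField.primitiveChar_to_Complex F
  have hsum := sum_unitPowSum_mul_eq_zero (r := r) hψ (a := a) (b := b) (c := c)
    fun x y z ↦ hno x y z x.ne_zero y.ne_zero z.ne_zero
  set n : ℝ := (Fintype.card Fˣ : ℝ) with hn
  set q : ℝ := (Fintype.card F : ℝ) with hq'
  have hnq : n = q - 1 := by
    rw [hn, hq', Fintype.card_eq_card_units_add_one (α := F)]
    push_cast
    ring
  have hn0 : 0 < n := by rw [hn]; exact_mod_cast Fintype.card_pos
  have hlt := mul_cube_lt_pow_four (r := r) (q := q) (by exact_mod_cast hr)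
    (by rw [hq']; exact_mod_cast hq)
  rw [← hnq] at hlt
  set E : ℝ := q * r - n with hE
  have hB (t : Fˣ) : ‖unitPowSum ψ r t‖ ≤ √(r * E) :=
    Real.le_sqrt_of_sq_le (norm_sq_unitPowSum_le hr0 hψ t)
  have hrE : 0 ≤ r * E := (sq_nonneg _).trans (norm_sq_unitPowSum_le hr0 hψ 1)
  have hmain := norm_sum_units_unitPowSum_mul_le hB (Units.mk0 a ha) (Units.mk0 b hb)
    (Units.mk0 c hc)
  simp only [Units.val_mul, Units.val_mk0] at hmain
  rw [sum_eq_apply_zero_add_sum_units] at hsum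
  rw [eq_neg_of_add_eq_zero_right hsum, norm_neg] at hmain
  simp only [zero_mul, unitPowSum_zero, norm_mul, Complex.norm_natCast] at hmain
  have hle : n * n * n ≤ √(r * E) * (n * E) := hmain.trans
    (mul_le_mul_of_nonneg_left (sum_units_norm_sq_unitPowSum_le hr0 hψ) (Real.sqrt_nonneg _))
  have hsq : n ^ 2 ≤ √(r * E) * E := by
    refine le_of_mul_le_mul_left ?_ hn0
    linarith
  have : n ^ 4 ≤ r * E ^ 3 := by
    calc n ^ 4 = (n ^ 2) ^ 2 := by ring
      _ ≤ (√(r * E) * E) ^ 2 := by gcongr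
      _ = r * E ^ 3 := by rw [mul_pow, Real.sq_sqrt hrE]; ring
  linarith
end

section
/- Let H be a hyperfield such that the multiplicative group H^× is finite and not cyclic, and such that 1 ⊞ (−1) ≠ H. Then H is not isomorphic to a quotient hyperfield F/G for any field F and subgroup G ≤ F^×. -/
/-- A hyperfield. -/
class Hyperfield (H : Type*) extends CommMonoid H, Zero H where
  hadd : H → H → Set H
  neg : H → H
  zero_ne_one : (0 : H) ≠ 1
  mul_zero : ∀ a : H, a * 0 = 0
  exists_inv : ∀ a : H, a ≠ 0 → ∃ b : H, a * b = 1
  hadd_nonempty : ∀ a b : H, (hadd a b).Nonempty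
  hadd_comm : ∀ a b : H, hadd a b = hadd b a
  hadd_assoc : ∀ a b c : H, (⋃ d ∈ hadd b c, hadd a d) = ⋃ d ∈ hadd a b, hadd d c
  zero_hadd : ∀ a : H, hadd 0 a = {a}
  neg_mem : ∀ a : H, (0 : H) ∈ hadd a (neg a)
  neg_unique : ∀ a b : H, (0 : H) ∈ hadd a b → b = neg a
  reversible : ∀ a b c : H, a ∈ hadd b c ↔ neg b ∈ hadd (neg a) c
  hadd_distrib : ∀ a b c : H, (fun d => a * d) '' hadd b c = hadd (a * b) (a * c)

universe u v

/-- A presentation of the hyperfield `H` as a quotient hyperfield `F/G`: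
a field `F`, a subgroup `G ≤ F^×`, and the quotient map `φ : F → H`, which is
surjective, identifies exactly the elements in a common coset of `G`
(and sends only `0` to `0`), preserves `1` and multiplication, and such that
`φ(a) ⊞ φ(b) = {[a' + b'] : a' ∈ aG, b' ∈ bG}`. -/
structure HyperfieldQuotientPresentation (H : Type v) [Hyperfield H] :
    Type (max (u + 1) v) where
  F : Type u
  [fieldF : Field F]
  G : Subgroup Fˣ
  φ : F → H
  surj : Function.Surjective φ
  zero_iff : ∀ x : F, φ x = 0 ↔ x = 0
  map_one : φ 1 = 1
  map_mul : ∀ x y : F, φ (x * y) = φ x * φ y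
  coset_iff : ∀ x y : Fˣ, φ x = φ y ↔ x⁻¹ * y ∈ G
  hadd_eq : ∀ a b : F, Hyperfield.hadd (φ a) (φ b) =
    {h : H | ∃ a' b' : F, φ a' = φ a ∧ φ b' = φ b ∧ φ (a' + b') = h}

/-- `H` is isomorphic to a quotient hyperfield `F/G` for some field `F` and
subgroup `G ≤ F^×`. -/
def IsQuotientHyperfield (H : Type v) [Hyperfield H] : Prop :=
  Nonempty (HyperfieldQuotientPresentation.{u, v} H)

/-- Over an infinite domain one can choose finitely many elements so that no nonempty subfamily
has sum zero. -/
theorem exists_forall_sum_ne_zero (R : Type*) [CommRing R] [IsDomain R] [Infinite R]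
    (ι : Type*) [Finite ι] :
    ∃ w : ι → R, ∀ s : Finset ι, s.Nonempty → ∑ i ∈ s, w i ≠ 0 := by
  classical
  have := Fintype.ofFinite ι
  let p : MvPolynomial ι R :=
    ∏ s ∈ (Finset.univ : Finset (Finset ι)).filter Finset.Nonempty, ∑ i ∈ s, MvPolynomial.X i
  have hp : p ≠ 0 := by
    refine Finset.prod_ne_zero_iff.mpr fun s hs h => ?_
    obtain ⟨j, hj⟩ := (Finset.mem_filter.mp hs).2
    have := congrArg (MvPolynomial.eval (Pi.single j (1 : R))) h
    simp [Pi.single_apply, hj] at this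
  obtain ⟨w, hw⟩ : ∃ w : ι → R, MvPolynomial.eval w p ≠ 0 := by
    by_contra! h
    exact hp (MvPolynomial.funext fun w => by simpa using h w)
  refine ⟨w, fun s hs h => hw ?_⟩
  rw [map_prod]
  exact Finset.prod_eq_zero (Finset.mem_filter.mpr ⟨Finset.mem_univ s, hs⟩) (by simpa using h)

/-- A form of van der Waerden's theorem valid in every infinite domain: for every finite colouring
and every finite family, some homothetic copy of the family, with nonzero ratio, is
monochromatic. -/
theorem exists_mono_homothetic_copy_of_infinite {R α κ : Type*} [CommRing R] [IsDomain R]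
    [Infinite R] [Finite α] [Finite κ] (σ : α → R) (C : R → κ) :
    ∃ d ≠ (0 : R), ∃ (b : R) (k : κ), ∀ x, C (d * σ x + b) = k := by
  classical
  obtain ⟨ι, _, hι⟩ := Combinatorics.Line.exists_mono_in_high_dimension α κ
  obtain ⟨w, hw⟩ := exists_forall_sum_ne_zero R ι
  obtain ⟨l, k, hl⟩ := hι fun v => C (∑ i, w i * σ (v i))
  obtain ⟨j, hj⟩ := l.proper
  refine ⟨∑ i with l.idxFun i = none, w i, hw _ ⟨j, by simpa using hj⟩,
    ∑ i with ¬ l.idxFun i = none, w i * ((l.idxFun i).map σ).getD 0, k, fun x => ?_⟩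
  rw [← hl x]
  dsimp only
  rw [← Finset.sum_filter_add_sum_filter_not Finset.univ (fun i => l.idxFun i = none)
    fun i => w i * σ (l x i), Finset.sum_mul]
  congr 2
  · refine Finset.sum_congr rfl fun i hi => ?_
    rw [l.apply_none x i (Finset.mem_filter.mp hi).2]
  · refine Finset.sum_congr rfl fun i hi => ?_
    obtain ⟨y, hy⟩ := Option.ne_none_iff_exists'.mp (Finset.mem_filter.mp hi).2
    rw [l.apply_some hy, hy]
    rfl

namespace HyperfieldQuotientPresentation

attribute [instance] fieldF

variable {H : Type v} [Hyperfield H] (P : HyperfieldQuotientPresentation.{u, v} H)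

theorem map_zero : P.φ 0 = 0 := (P.zero_iff 0).mpr rfl

theorem map_neg_one : P.φ (-1) = Hyperfield.neg 1 := by
  apply Hyperfield.neg_unique
  rw [← P.map_one, P.hadd_eq]
  exact ⟨1, -1, rfl, rfl, by rw [add_neg_cancel, P.map_zero]⟩

theorem hadd_one_neg_one_eq_univ [Finite H] [Infinite P.F] :
    Hyperfield.hadd (1 : H) (Hyperfield.neg 1) = Set.univ := by
  refine Set.eq_univ_of_forall fun h => ?_
  obtain ⟨c, rfl⟩ := P.surj h
  obtain ⟨σ, hσ⟩ := P.surj.hasRightInverse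
  obtain ⟨d, hd, b, k, hk⟩ := exists_mono_homothetic_copy_of_infinite σ P.φ
  have h0 : σ 0 = 0 := (P.zero_iff _).mp (hσ 0)
  have hφb : P.φ b = k := by simpa [h0] using hk 0
  have hb : b ≠ 0 := by
    rintro rfl
    have h1 := hk 1
    rw [add_zero, ← hφb, P.map_zero, P.zero_iff] at h1
    have h2 := hσ 1
    rw [(mul_eq_zero.mp h1).resolve_left hd, P.map_zero] at h2
    exact Hyperfield.zero_ne_one h2
  have he := hk (P.φ (d⁻¹ * b * c))
  have hφe := hσ (P.φ (d⁻¹ * b * c))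
  set e := σ (P.φ (d⁻¹ * b * c))
  rw [← P.map_neg_one, ← P.map_one, P.hadd_eq]
  refine ⟨b⁻¹ * (d * e + b), -1, ?_, rfl, ?_⟩
  · rw [P.map_mul, he, ← hφb, ← P.map_mul, inv_mul_cancel₀ hb]
  · have h1 : b⁻¹ * (d * e + b) + -1 = b⁻¹ * d * e := by field_simp; ring
    rw [h1, P.map_mul, hφe, ← P.map_mul]
    congr 1
    field_simp

theorem exists_forall_eq_pow [Finite P.F] : ∃ g : H, ∀ x : H, x ≠ 0 → ∃ n : ℕ, x = g ^ n := by
  let f : P.F →* H := ⟨⟨P.φ, P.map_one⟩, P.map_mul⟩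
  obtain ⟨u, hu⟩ := IsCyclic.exists_monoid_generator (α := P.Fˣ)
  refine ⟨f u, fun x hx => ?_⟩
  obtain ⟨y, rfl⟩ := P.surj x
  have hy : y ≠ 0 := fun h => hx ((P.zero_iff y).mpr h)
  obtain ⟨n, hn⟩ := hu (Units.mk0 y hy)
  refine ⟨n, ?_⟩
  rw [← map_pow, ← Units.val_pow_eq_pow_val]
  exact congrArg P.φ (congrArg Units.val hn).symm

end HyperfieldQuotientPresentation

/-- A hyperfield with finite non-cyclic multiplicative group `H^×` and with
`1 ⊞ (-1) ≠ H` is not a quotient of any field (by a subgroup of its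
multiplicative group). -/
theorem stmt_19 (H : Type v) [Hyperfield H]
    (hfin : Finite {x : H // x ≠ 0})
    (hnotcyclic : ¬∃ g : H, ∀ x : H, x ≠ 0 → ∃ n : ℕ, x = g ^ n)
    (hadd_ne : Hyperfield.hadd (1 : H) (Hyperfield.neg 1) ≠ Set.univ) :
    ¬IsQuotientHyperfield.{u, v} H := by
  rintro ⟨P⟩
  have hne : {x : H | x ≠ 0}.Finite := Set.finite_coe_iff.mp hfin
  have : Finite H := Set.finite_univ_iff.mp <|
    ((Set.finite_singleton (0 : H)).union hne).subset
      fun x _ => em (x = 0)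
  cases finite_or_infinite P.F
  · exact hnotcyclic P.exists_forall_eq_pow
  · exact hadd_ne P.hadd_one_neg_one_eq_univ
end
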